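/- Let P be a ground DLP< program consisting of a single object o = (oid(o), Σ(o)). Then a set of literals M is a DLP<-answer set of P if and only if M is a consistent answer set of the disjunctive logic program Σ(o) in the sense of Gelfond–Lifschitz. -/

import Mathlib

/-- A literal: an atom `p` or its strong negation `¬p`. -/
inductive Lit (α : Type) : Type where
  | pos : α → Lit α
  | neg : α → Lit α
deriving DecidableEq

/-- The complementary literal `¬.L`. -/
def Lit.compl {α : Type} : Lit α → Lit α
  | .pos a => .neg a
  | .neg a => .pos a

/-- A ground rule with head, positive body, NAF body, a defeasible/strict marker,
    labelled with the object it belongs to. -/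
structure Rule (α κ : Type) : Type where
  head : Set (Lit α)
  bodyPos : Set (Lit α)
  bodyNeg : Set (Lit α)
  defeasible : Bool
  obj : κ

/-- A ground DLP< program: a finite multiset of object-labelled rules (here: a finite set,
    since rules carry their object label), with nonempty heads, together with a strict
    partial order `<` on objects. -/
structure Program (α κ : Type) : Type where
  rules : Set (Rule α κ)
  lt : κ → κ → Prop
  lt_irrefl : ∀ o, ¬ lt o o
  lt_trans : ∀ a b c, lt a b → lt b c → lt a c
  rules_fin : rules.Finite
  head_ne : ∀ r ∈ rules, r.head.Nonempty

/-- A set of literals is consistent if it contains no complementary pair. -/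
def consistent {α : Type} (I : Set (Lit α)) : Prop :=
  ∀ L ∈ I, Lit.compl L ∉ I

/-- The body of `r` is true in `I`. -/
def bodyTrue {α κ : Type} (I : Set (Lit α)) (r : Rule α κ) : Prop :=
  r.bodyPos ⊆ I ∧ ∀ L ∈ r.bodyNeg, L ∉ I

/-- `r` is satisfied in `I`. -/
def satisfied {α κ : Type} (I : Set (Lit α)) (r : Rule α κ) : Prop :=
  (∃ L ∈ r.head, L ∈ I) ∨ ¬ bodyTrue I r

/-- `r1` overrides `r2` on `L` in `I`. -/
def overridesOn {α κ : Type} (P : Program α κ) (I : Set (Lit α))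
    (r1 r2 : Rule α κ) (L : Lit α) : Prop :=
  Lit.compl L ∈ r1.head ∧ L ∈ r2.head ∧ P.lt r1.obj r2.obj ∧
    r2.defeasible = true ∧ Lit.compl L ∈ I ∧ bodyTrue I r2

/-- `r` is overridden in `I`. -/
def overridden {α κ : Type} (P : Program α κ) (I : Set (Lit α)) (r : Rule α κ) : Prop :=
  ∀ L ∈ r.head, ∃ r1 ∈ P.rules, overridesOn P I r1 r L

/-- `I` is a model of `P`: a consistent set of literals in which every rule is
    satisfied or overridden. -/
def isModel {α κ : Type} (P : Program α κ) (I : Set (Lit α)) : Prop :=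
  consistent I ∧ ∀ r ∈ P.rules, satisfied I r ∨ overridden P I r

/-- A NAF-free ground rule (rules of a reduct, read positively: pos(·) treats
    each strongly negated literal as a fresh atom, which is reflected by placing
    no consistency requirement on models of such rules). -/
structure PosRule (α : Type) : Type where
  head : Set (Lit α)
  body : Set (Lit α)

/-- The reduct G_I(P): delete rules overridden in `I`, delete rules whose NAF body
    clashes with `I`, strip the NAF parts of the remaining rules. -/
def reduct {α κ : Type} (P : Program α κ) (I : Set (Lit α)) : Set (PosRule α) :=
  { s | ∃ r ∈ P.rules, ¬ overridden P I r ∧ (∀ L ∈ r.bodyNeg, L ∉ I) ∧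
        s = PosRule.mk r.head r.bodyPos }

/-- Satisfaction of a NAF-free rule by an arbitrary set of literals (pos-reading). -/
def posSat {α : Type} (I : Set (Lit α)) (s : PosRule α) : Prop :=
  s.body ⊆ I → ∃ L ∈ s.head, L ∈ I

/-- `I` is a model of the positive program `S` (pos-reading: no consistency needed). -/
def posModel {α : Type} (S : Set (PosRule α)) (I : Set (Lit α)) : Prop :=
  ∀ s ∈ S, posSat I s

/-- `M` is a DLP<-answer set of `P`: a model of `P` which is a minimal model of
    pos(G_M(P)). -/
def isAnswerSet {α κ : Type} (P : Program α κ) (M : Set (Lit α)) : Prop :=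
  isModel P M ∧ posModel (reduct P M) M ∧ ∀ N, N ⊂ M → ¬ posModel (reduct P M) N

/-- The Gelfond–Lifschitz reduct Π^M of a set of ground rules: delete each rule whose
    NAF body clashes with `M`, strip the NAF parts of the remaining rules. -/
def glReduct {α κ : Type} (S : Set (Rule α κ)) (M : Set (Lit α)) : Set (PosRule α) :=
  { s | ∃ r ∈ S, (∀ L ∈ r.bodyNeg, L ∉ M) ∧ s = PosRule.mk r.head r.bodyPos }

/-- A candidate set for the GL answer-set construction over a NAF-free program:
    closed under the rules, and if it contains a complementary pair it must be the
    set of all literals. -/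
def glCandidate {α : Type} (S : Set (PosRule α)) (M : Set (Lit α)) : Prop :=
  posModel S M ∧ (¬ consistent M → M = Set.univ)

/-- GL answer set of a NAF-free program: a subset-minimal candidate set. -/
def glAnswerSetPos {α : Type} (S : Set (PosRule α)) (M : Set (Lit α)) : Prop :=
  glCandidate S M ∧ ∀ N, N ⊂ M → ¬ glCandidate S N

/-- GL answer set of a set of ground rules with NAF: answer set of the GL reduct. -/
def glAnswerSet {α κ : Type} (S : Set (Rule α κ)) (M : Set (Lit α)) : Prop :=
  glAnswerSetPos (glReduct S M) M

theorem consistent.mono {α : Type} {I J : Set (Lit α)} (hJ : consistent J) (hIJ : I ⊆ J) :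
    consistent I :=
  fun L hL hLc => hJ L (hIJ hL) (hIJ hLc)

theorem not_overridden_of_single_object {α κ : Type} (P : Program α κ) {o : κ}
    (hsingle : ∀ r ∈ P.rules, r.obj = o) (I : Set (Lit α)) {r : Rule α κ} (hr : r ∈ P.rules) :
    ¬ overridden P I r := by
  intro h
  obtain ⟨L, hL⟩ := P.head_ne r hr
  obtain ⟨r₁, hr₁, -, -, hlt, -⟩ := h L hL
  rw [hsingle r₁ hr₁, hsingle r hr] at hlt
  exact P.lt_irrefl o hlt

theorem reduct_eq_glReduct_of_single_object {α κ : Type} (P : Program α κ) {o : κ}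
    (hsingle : ∀ r ∈ P.rules, r.obj = o) (I : Set (Lit α)) :
    reduct P I = glReduct P.rules I := by
  ext s
  constructor
  · rintro ⟨r, hr, -, h⟩
    exact ⟨r, hr, h⟩
  · rintro ⟨r, hr, h⟩
    exact ⟨r, hr, not_overridden_of_single_object P hsingle I hr, h⟩

theorem satisfied_of_posModel_glReduct {α κ : Type} {S : Set (Rule α κ)} {I : Set (Lit α)}
    (h : posModel (glReduct S I) I) {r : Rule α κ} (hr : r ∈ S) : satisfied I r := by
  by_cases hb : bodyTrue I r
  · exact Or.inl (h _ ⟨r, hr, hb.2, rfl⟩ hb.1)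
  · exact Or.inr hb

theorem glCandidate_iff_posModel {α : Type} {S : Set (PosRule α)} {I : Set (Lit α)}
    (hI : consistent I) : glCandidate S I ↔ posModel S I :=
  ⟨fun h => h.1, fun h => ⟨h, fun hn => absurd hI hn⟩⟩

/-- for a single-object program `P` with rule set `Σ(o)`, `M` is a
    DLP<-answer set of `P` iff `M` is a consistent GL answer set of `Σ(o)`. -/
theorem stmt_6 {α κ : Type} (P : Program α κ) (o : κ)
    (hsingle : ∀ r ∈ P.rules, r.obj = o)
    (M : Set (Lit α)) :
    isAnswerSet P M ↔ (glAnswerSet P.rules M ∧ consistent M) := by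
  rw [isAnswerSet, reduct_eq_glReduct_of_single_object P hsingle, glAnswerSet, glAnswerSetPos]
  constructor
  · rintro ⟨⟨hcons, -⟩, hM, hmin⟩
    exact ⟨⟨(glCandidate_iff_posModel hcons).2 hM, fun N hN h => hmin N hN h.1⟩, hcons⟩
  · rintro ⟨⟨hM, hmin⟩, hcons⟩
    exact ⟨⟨hcons, fun r hr => Or.inl (satisfied_of_posModel_glReduct hM.1 hr)⟩, hM.1,
      fun N hN h => hmin N hN ((glCandidate_iff_posModel (hcons.mono hN.subset)).2 h)⟩
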